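/- Let f : ℝⁿ → ℝ be a smooth ℤⁿ-periodic function and let V, W : ℝⁿ → ℝⁿ be smooth ℤⁿ-periodic vector fields. Then ∫_{[0,1]ⁿ} (div_f V)(x) (div_f W)(x) e^{-f(x)} dx = ∫_{[0,1]ⁿ} [ Σ_{i,j} ∂_j V_i(x) ∂_i W_j(x) + V(x)·(D²f(x) W(x)) ] e^{-f(x)} dx. -/

import Mathlib

noncomputable section

open MeasureTheory

variable {n : ℕ}

/-- `i`-th partial derivative. -/
def pderiv1 (u : (Fin n → ℝ) → ℝ) (i : Fin n) (x : Fin n → ℝ) : ℝ :=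
  fderiv ℝ u x (Pi.single i 1)

/-- Gradient. -/
def grad (u : (Fin n → ℝ) → ℝ) (x : Fin n → ℝ) : Fin n → ℝ :=
  fun i => pderiv1 u i x

/-- Hessian matrix. -/
def hess (u : (Fin n → ℝ) → ℝ) (x : Fin n → ℝ) : Matrix (Fin n) (Fin n) ℝ :=
  Matrix.of fun i j => pderiv1 (pderiv1 u j) i x

/-- Laplacian. -/
def lap (u : (Fin n → ℝ) → ℝ) (x : Fin n → ℝ) : ℝ :=
  ∑ i, pderiv1 (pderiv1 u i) i x

/-- Euclidean dot product. -/
def dot (a b : Fin n → ℝ) : ℝ := ∑ i, a i * b i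

/-- ℤⁿ-periodicity. -/
def ZPeriodic (u : (Fin n → ℝ) → ℝ) : Prop :=
  ∀ (x : Fin n → ℝ) (k : Fin n → ℤ), u (x + fun i => (k i : ℝ)) = u x

/-- Area element `Q(p) = √(1+|p|²)`. -/
def Qe (p : Fin n → ℝ) : ℝ := Real.sqrt (1 + ∑ i, p i ^ 2)

/-- `v(p) = p / √(1+|p|²)`. -/
def vv (p : Fin n → ℝ) : Fin n → ℝ := fun i => p i / Qe p

/-- Divergence of a vector field. -/
def dvg (V : (Fin n → ℝ) → (Fin n → ℝ)) (x : Fin n → ℝ) : ℝ :=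
  ∑ i, fderiv ℝ (fun y => V y i) x (Pi.single i 1)

/-- Weighted divergence `div_f V = div V − ∇f·V`. -/
def divf (f : (Fin n → ℝ) → ℝ) (V : (Fin n → ℝ) → (Fin n → ℝ)) (x : Fin n → ℝ) : ℝ :=
  dvg V x - dot (grad f x) (V x)

/-- Frobenius inner product of matrices. -/
def frob (A B : Matrix (Fin n) (Fin n) ℝ) : ℝ := ∑ i, ∑ j, A i j * B i j

/-! ### Calculus of `pderiv1` -/

theorem ContDiff.pderiv1 {u : (Fin n → ℝ) → ℝ} (hu : ContDiff ℝ (⊤ : ℕ∞) u) (i : Fin n) :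
    ContDiff ℝ (⊤ : ℕ∞) (pderiv1 u i) :=
  (hu.fderiv_right (m := (⊤ : ℕ∞)) (by simp)).clm_apply contDiff_const

theorem ZPeriodic.pderiv1 {u : (Fin n → ℝ) → ℝ} (hu : ZPeriodic u) (i : Fin n) :
    ZPeriodic (pderiv1 u i) := by
  intro x k
  have h : (fun y => u (y + fun i => (k i : ℝ))) = u := funext fun y => hu y k
  unfold _root_.pderiv1
  rw [← fderiv_comp_add_right, h]

theorem pderiv1_mul {u v : (Fin n → ℝ) → ℝ} {x : Fin n → ℝ} (i : Fin n)
    (hu : DifferentiableAt ℝ u x) (hv : DifferentiableAt ℝ v x) :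
    pderiv1 (fun y => u y * v y) i x = pderiv1 u i x * v x + u x * pderiv1 v i x := by
  simp only [pderiv1, fderiv_fun_mul hu hv, add_apply, smul_apply, smul_eq_mul]
  ring

theorem pderiv1_sub {u v : (Fin n → ℝ) → ℝ} {x : Fin n → ℝ} (i : Fin n)
    (hu : DifferentiableAt ℝ u x) (hv : DifferentiableAt ℝ v x) :
    pderiv1 (fun y => u y - v y) i x = pderiv1 u i x - pderiv1 v i x := by
  simp [pderiv1, fderiv_fun_sub hu hv]

theorem pderiv1_sum {ι : Type*} {s : Finset ι} {u : ι → (Fin n → ℝ) → ℝ} {x : Fin n → ℝ}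
    (i : Fin n) (hu : ∀ j ∈ s, DifferentiableAt ℝ (u j) x) :
    pderiv1 (fun y => ∑ j ∈ s, u j y) i x = ∑ j ∈ s, pderiv1 (u j) i x := by
  simp [pderiv1, fderiv_fun_sum hu]

theorem pderiv1_exp_neg {u : (Fin n → ℝ) → ℝ} {x : Fin n → ℝ} (i : Fin n)
    (hu : DifferentiableAt ℝ u x) :
    pderiv1 (fun y => Real.exp (-u y)) i x = -(Real.exp (-u x) * pderiv1 u i x) := by
  simp [pderiv1, fderiv_exp hu.fun_neg]

/-- Second partial derivatives of a smooth function commute. -/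
theorem pderiv1_comm {u : (Fin n → ℝ) → ℝ} (hu : ContDiff ℝ (⊤ : ℕ∞) u) (i j : Fin n)
    (x : Fin n → ℝ) : pderiv1 (pderiv1 u i) j x = pderiv1 (pderiv1 u j) i x := by
  have hd : DifferentiableAt ℝ (fderiv ℝ u) x :=
    (hu.fderiv_right (m := (⊤ : ℕ∞)) (by simp)).differentiable (by simp) x
  have key : ∀ a b : Fin n, pderiv1 (pderiv1 u a) b x =
      fderiv ℝ (fderiv ℝ u) x (Pi.single b 1) (Pi.single a 1) := fun a b => by
    change fderiv ℝ (fun y => fderiv ℝ u y (Pi.single a 1)) x (Pi.single b 1) = _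
    rw [fderiv_clm_apply hd (by fun_prop)]
    simp
  rw [key, key]
  exact hu.contDiffAt.isSymmSndFDerivAt (by
    rw [minSmoothness_of_isRCLikeNormedField]
    exact WithTop.coe_le_coe.2 (le_top (a := (2 : ℕ∞)))) _ _

/-- The divergence of a periodic vector field integrates to zero over the fundamental domain. -/
theorem setIntegral_sum_pderiv1_eq_zero (X : Fin n → (Fin n → ℝ) → ℝ)
    (hX : ∀ i, ContDiff ℝ (⊤ : ℕ∞) (X i)) (hXp : ∀ i, ZPeriodic (X i)) :
    ∫ x in Set.Icc (0 : Fin n → ℝ) 1, ∑ i, pderiv1 (X i) i x = 0 := by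
  cases n with
  | zero => simp
  | succ m =>
    have hcont : Continuous fun x => ∑ i, pderiv1 (X i) i x :=
      continuous_finsetSum _ fun i _ => ((hX i).pderiv1 i).continuous
    refine (integral_divergence_of_hasFDerivAt_off_countable' 0 1 zero_le_one X
      (fun i => fderiv ℝ (X i)) ∅ Set.countable_empty (fun i => (hX i).continuous.continuousOn)
      (fun x _ i => ((hX i).differentiable (by simp) x).hasFDerivAt)
      hcont.integrableOn_Icc).trans (Finset.sum_eq_zero fun i _ => sub_eq_zero.2 ?_)
    congr 1
    funext y
    rw [← hXp i (i.insertNth ((0 : Fin (m + 1) → ℝ) i) y) (Pi.single i 1)]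
    congr 1
    funext j
    refine Fin.succAboveCases i ?_ (fun k => ?_) j <;> simp

theorem sum_weighted_bochner_algebra {ι R : Type*} [Fintype ι] [CommRing R] (a b F : ι → R)
    (A B H : ι → ι → R) (C : ι → ι → ι → R) (hC : ∀ i j k, C i j k = C i k j) :
    ∑ i, (-F i * (a i * ∑ j, (B j j - F j * b j) - ∑ j, a j * B i j) +
      (A i i * ∑ j, (B j j - F j * b j) +
        a i * ∑ j, (C j j i - (H i j * b j + F j * B j i)) -
        ∑ j, (A j i * B i j + a j * C i j i))) =
      (∑ i, A i i - ∑ i, F i * a i) * (∑ i, B i i - ∑ i, F i * b i) -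
        (∑ i, ∑ j, A i j * B j i + ∑ i, a i * ∑ j, H i j * b j) := by
  have h₁ : ∑ i, ∑ j, F i * (a j * B i j) = ∑ i, ∑ j, a i * (F j * B j i) := by
    rw [Finset.sum_comm]
    simp only [mul_left_comm]
  have h₂ : ∑ i, ∑ j, a j * C i j i = ∑ i, ∑ j, a i * C j j i := by
    rw [Finset.sum_comm]
    exact Finset.sum_congr rfl fun i _ => Finset.sum_congr rfl fun j _ => by rw [hC]
  have h₃ : ∑ i, ∑ j, A j i * B i j = ∑ i, ∑ j, A i j * B j i := Finset.sum_comm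
  rw [← Finset.sum_sub_distrib (fun i => B i i)]
  set g := ∑ j, (B j j - F j * b j)
  simp only [mul_sub, neg_mul, mul_add, Finset.sum_add_distrib, Finset.sum_sub_distrib,
    Finset.sum_neg_distrib, Finset.mul_sum, sub_mul, Finset.sum_mul] at *
  rw [h₁, h₂, h₃]
  simp only [mul_assoc]
  ring

section

variable {f : (Fin n → ℝ) → ℝ} {V W : (Fin n → ℝ) → (Fin n → ℝ)}

/-- Components of the vector field `e^{-f} ((div_f W) V - D_V W)`, whose divergence is the
difference of the two sides of the weighted Bochner identity. -/
def bochnerField (f : (Fin n → ℝ) → ℝ) (V W : (Fin n → ℝ) → (Fin n → ℝ)) (i : Fin n)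
    (y : Fin n → ℝ) : ℝ :=
  Real.exp (-f y) *
    (V y i * ∑ j, (pderiv1 (fun z => W z j) j y - pderiv1 f j y * W y j) -
      ∑ j, V y j * pderiv1 (fun z => W z i) j y)

theorem contDiff_bochnerField (hf : ContDiff ℝ (⊤ : ℕ∞) f) (hV : ContDiff ℝ (⊤ : ℕ∞) V)
    (hW : ContDiff ℝ (⊤ : ℕ∞) W) (i : Fin n) :
    ContDiff ℝ (⊤ : ℕ∞) (bochnerField f V W i) := by
  have hv := contDiff_pi.1 hV
  have hw := contDiff_pi.1 hW
  refine hf.neg.exp.mul (((hv i).mul (ContDiff.sum fun j _ => ?_)).sub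
    (ContDiff.sum fun j _ => (hv j).mul ((hw i).pderiv1 j)))
  exact ((hw j).pderiv1 j).sub ((hf.pderiv1 j).mul (hw j))

theorem zPeriodic_bochnerField (hfp : ZPeriodic f)
    (hVp : ∀ (x : Fin n → ℝ) (k : Fin n → ℤ), V (x + fun i => (k i : ℝ)) = V x)
    (hWp : ∀ (x : Fin n → ℝ) (k : Fin n → ℤ), W (x + fun i => (k i : ℝ)) = W x) (i : Fin n) :
    ZPeriodic (bochnerField f V W i) := by
  intro x k
  have hw : ∀ j, ZPeriodic fun z => W z j := fun j y l => congrFun (hWp y l) j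
  simp only [bochnerField, hfp x k, hVp x k, hWp x k, (hfp.pderiv1 _) x k,
    ((hw _).pderiv1 _) x k]

theorem sum_pderiv1_bochnerField (hf : ContDiff ℝ (⊤ : ℕ∞) f) (hV : ContDiff ℝ (⊤ : ℕ∞) V)
    (hW : ContDiff ℝ (⊤ : ℕ∞) W) (x : Fin n → ℝ) :
    ∑ i, pderiv1 (bochnerField f V W i) i x =
      divf f V x * divf f W x * Real.exp (-f x) -
        ((∑ i, ∑ j, (fderiv ℝ (fun y => V y i) x (Pi.single j 1)) *
              (fderiv ℝ (fun y => W y j) x (Pi.single i 1)))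
          + dot (V x) ((hess f x).mulVec (W x))) * Real.exp (-f x) := by
  have diff : ∀ {u : (Fin n → ℝ) → ℝ}, ContDiff ℝ (⊤ : ℕ∞) u → DifferentiableAt ℝ u x :=
    fun hu => hu.differentiable (by simp) x
  have hv := contDiff_pi.1 hV
  have hw := contDiff_pi.1 hW
  have hS : ∀ j, ContDiff ℝ (⊤ : ℕ∞)
      fun y => pderiv1 (fun z => W z j) j y - pderiv1 f j y * W y j :=
    fun j => ((hw j).pderiv1 j).sub ((hf.pderiv1 j).mul (hw j))
  have hT : ∀ i j, ContDiff ℝ (⊤ : ℕ∞) fun y => V y j * pderiv1 (fun z => W z i) j y :=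
    fun i j => (hv j).mul ((hw i).pderiv1 j)
  have hD : ∀ i, pderiv1 (bochnerField f V W i) i x = Real.exp (-f x) *
      (-pderiv1 f i x *
        (V x i * ∑ j, (pderiv1 (fun z => W z j) j x - pderiv1 f j x * W x j) -
          ∑ j, V x j * pderiv1 (fun z => W z i) j x) +
      (pderiv1 (fun z => V z i) i x *
          ∑ j, (pderiv1 (fun z => W z j) j x - pderiv1 f j x * W x j) +
        V x i * ∑ j, (pderiv1 (pderiv1 (fun z => W z j) j) i x -
          (pderiv1 (pderiv1 f j) i x * W x j + pderiv1 f j x * pderiv1 (fun z => W z j) i x)) -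
        ∑ j, (pderiv1 (fun z => V z j) i x * pderiv1 (fun z => W z i) j x +
          V x j * pderiv1 (pderiv1 (fun z => W z i) j) i x))) := by
    intro i
    have hSs := ContDiff.sum (s := Finset.univ) fun j _ => hS j
    have hTs := ContDiff.sum (s := Finset.univ) fun j _ => hT i j
    unfold bochnerField
    rw [pderiv1_mul i (diff hf.neg.exp) (diff (((hv i).mul hSs).sub hTs)),
      pderiv1_exp_neg i (diff hf), pderiv1_sub i (diff ((hv i).mul hSs)) (diff hTs),
      pderiv1_mul i (diff (hv i)) (diff hSs), pderiv1_sum i fun j _ => diff (hS j),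
      pderiv1_sum i fun j _ => diff (hT i j)]
    simp only [fun j => pderiv1_sub i (diff ((hw j).pderiv1 j))
        (diff ((hf.pderiv1 j).mul (hw j))),
      fun j => pderiv1_mul i (diff (hf.pderiv1 j)) (diff (hw j)),
      fun j => pderiv1_mul i (diff (hv j)) (diff ((hw i).pderiv1 j))]
    ring
  simp only [hD]
  rw [← Finset.mul_sum, sum_weighted_bochner_algebra (V x) (W x) (fun i => pderiv1 f i x)
    (fun i j => pderiv1 (fun z => V z i) j x) (fun i j => pderiv1 (fun z => W z i) j x)
    (fun i j => pderiv1 (pderiv1 f j) i x)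
    (fun i j k => pderiv1 (pderiv1 (fun z => W z i) j) k x)
    (fun i j k => pderiv1_comm (hw i) j k x), mul_comm, sub_mul]
  rfl

end

/-- weighted Bochner identity for vector fields:
`∫ (div_f V)(div_f W) e^{-f} = ∫ [Σ_{i,j} ∂_j V_i ∂_i W_j + V·(D²f W)] e^{-f}`
over `[0,1]ⁿ` for smooth ℤⁿ-periodic `f, V, W`. -/
theorem weighted_bochner_vector_fields
    (f : (Fin n → ℝ) → ℝ) (V W : (Fin n → ℝ) → (Fin n → ℝ))
    (hf : ContDiff ℝ (⊤ : ℕ∞) f)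
    (hV : ContDiff ℝ (⊤ : ℕ∞) V) (hW : ContDiff ℝ (⊤ : ℕ∞) W)
    (hfp : ZPeriodic f)
    (hVp : ∀ (x : Fin n → ℝ) (k : Fin n → ℤ), V (x + fun i => (k i : ℝ)) = V x)
    (hWp : ∀ (x : Fin n → ℝ) (k : Fin n → ℤ), W (x + fun i => (k i : ℝ)) = W x) :
    ∫ x in Set.Icc (0 : Fin n → ℝ) 1,
        divf f V x * divf f W x * Real.exp (-f x) =
      ∫ x in Set.Icc (0 : Fin n → ℝ) 1,
        ((∑ i, ∑ j, (fderiv ℝ (fun y => V y i) x (Pi.single j 1)) *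
              (fderiv ℝ (fun y => W y j) x (Pi.single i 1)))
          + dot (V x) ((hess f x).mulVec (W x))) * Real.exp (-f x) := by
  have hv := contDiff_pi.1 hV
  have hw := contDiff_pi.1 hW
  have hdvg : ∀ {U : (Fin n → ℝ) → (Fin n → ℝ)}, ContDiff ℝ (⊤ : ℕ∞) U →
      Continuous (divf f U) := fun hU =>
    (continuous_finsetSum _ fun i _ => ((contDiff_pi.1 hU i).pderiv1 i).continuous).sub
      (continuous_finsetSum _ fun i _ =>
        (hf.pderiv1 i).continuous.mul (contDiff_pi.1 hU i).continuous)
  have hexp : Continuous fun x => Real.exp (-f x) := hf.neg.exp.continuous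
  rw [← sub_eq_zero, ← integral_sub]
  · simp only [← sum_pderiv1_bochnerField hf hV hW]
    exact setIntegral_sum_pderiv1_eq_zero _ (contDiff_bochnerField hf hV hW)
      (zPeriodic_bochnerField hfp hVp hWp)
  · exact (((hdvg hV).mul (hdvg hW)).mul hexp).integrableOn_Icc
  · refine Continuous.integrableOn_Icc (Continuous.mul (Continuous.add ?_ ?_) hexp)
    · exact continuous_finsetSum _ fun i _ => continuous_finsetSum _ fun j _ =>
        ((hv i).pderiv1 j).continuous.mul ((hw j).pderiv1 i).continuous
    · exact continuous_finsetSum _ fun i _ => (hv i).continuous.mul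
        (show Continuous fun x => ∑ j, pderiv1 (pderiv1 f j) i x * W x j from
          continuous_finsetSum _ fun j _ => ((hf.pderiv1 j).pderiv1 i).continuous.mul (hw j).continuous)
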